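/- Fix d ≥ 1, E > 0 and ε > 0. There exists C > 0 such that for every integer N ≥ 1, setting ħ = ħ_N(E), sup_{(x,ξ) : H(x,ξ) ≥ ε} |W_{ħ,N}(x,ξ)| ≤ C ħ^{−d+1/3}. (Away from the origin of phase space, the Wigner distribution of an eigenspace projection is O(ħ^{−d+1/3}), in contrast to its value of order ħ^{−d} N^{d−1} at the origin.) -/

import Mathlib

open MeasureTheory Real Filter
open scoped BigOperators ENNReal

noncomputable section

/-- Physicists' Hermite polynomials `H_n`. -/
def physHermite : ℕ → Polynomial ℝ
  | 0 => 1
  | n + 1 => 2 * Polynomial.X * physHermite n - Polynomial.derivative (physHermite n)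

/-- The `L²`-normalized Hermite function `φ_n`. -/
def hermiteFun (n : ℕ) (t : ℝ) : ℝ :=
  ((2 : ℝ) ^ n * (n.factorial : ℝ) * Real.sqrt π) ^ (-(1 : ℝ) / 2) *
    (physHermite n).eval t * Real.exp (-t ^ 2 / 2)

/-- The product Hermite function `φ_α` on `ℝ^d`. -/
def hermiteProd {d : ℕ} (α : Fin d → ℕ) (x : Fin d → ℝ) : ℝ :=
  ∏ j, hermiteFun (α j) (x j)

/-- The rescaled Hermite eigenfunction `φ_{α,hb}(x) = hb^{-d/4} φ_α(hb^{-1/2} x)`. -/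
def hermiteProdH {d : ℕ} (hb : ℝ) (α : Fin d → ℕ) (x : Fin d → ℝ) : ℝ :=
  hb ^ (-(d : ℝ) / 4) * hermiteProd α fun j => hb ^ (-(1 : ℝ) / 2) * x j

/-- The eigenspace projection kernel `Π_{hb,N}(x,y) = Σ_{|α|=N} φ_{α,hb}(x) φ_{α,hb}(y)`. -/
def projKer (d : ℕ) (hb : ℝ) (N : ℕ) (x y : Fin d → ℝ) : ℝ :=
  ∑ α ∈ Finset.Nat.antidiagonalTuple d N, hermiteProdH hb α x * hermiteProdH hb α y

/-- Euclidean dot product on `ℝ^d`. -/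
def dotR {d : ℕ} (v ξ : Fin d → ℝ) : ℝ := ∑ j, v j * ξ j

/-- The Wigner distribution of the `N`-th eigenspace projection,
`W_{hb,N}(x,ξ) = (2πhb)^{-d} ∫ Π_{hb,N}(x+v/2, x-v/2) e^{-i v·ξ/hb} dv`. -/
def wigner (d : ℕ) (hb : ℝ) (N : ℕ) (x ξ : Fin d → ℝ) : ℂ :=
  ((((2 * π * hb) ^ d)⁻¹ : ℝ) : ℂ) *
    ∫ v : Fin d → ℝ,
      ((projKer d hb N (fun j => x j + v j / 2) (fun j => x j - v j / 2) : ℝ) : ℂ) *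
        Complex.exp (-Complex.I * (dotR v ξ : ℂ) / (hb : ℂ))

/-- The classical Hamiltonian `H(x,ξ) = (|x|² + |ξ|²)/2`. -/
def Hfun {d : ℕ} (x ξ : Fin d → ℝ) : ℝ := ((∑ j, x j ^ 2) + ∑ j, ξ j ^ 2) / 2

/-- `hb_N(E) = E/(N + d/2)`, so that `E_N(hb) = hb(N + d/2) = E`. -/
def hPl (d : ℕ) (E : ℝ) (N : ℕ) : ℝ := E / ((N : ℝ) + (d : ℝ) / 2)

/-- The Airy function `Ai(s) = (1/π) lim_{T→∞} ∫_0^T cos(t³/3 + s t) dt`. -/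
def airy (s : ℝ) : ℝ :=
  (1 / π) * limUnder Filter.atTop fun T : ℝ => ∫ t in (0 : ℝ)..T, Real.cos (t ^ 3 / 3 + s * t)


lemma vdc2 (φ φ1 φ2 : ℝ → ℝ) (U : Set ℝ) (hU : IsOpen U) (a b μ : ℝ) (hab : a ≤ b)
    (hsub : Set.Icc a b ⊆ U) (hμ : 0 < μ)
    (h1 : ∀ x ∈ U, HasDerivAt φ (φ1 x) x) (h2 : ∀ x ∈ U, HasDerivAt φ1 (φ2 x) x)
    (h3 : ∀ x ∈ Set.Icc a b, μ ≤ φ2 x) :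
    ‖∫ x in a..b, Complex.exp (Complex.I * (φ x : ℂ))‖ ≤ 8 / √μ := by
  set s := √μ with hs
  have hs0 : 0 < s := Real.sqrt_pos.2 hμ
  have hs2 : s ^ 2 = μ := Real.sq_sqrt hμ.le
  set e : ℝ → ℂ := fun x => Complex.exp (Complex.I * (φ x : ℂ)) with he
  have hed : ∀ x ∈ U, HasDerivAt e (e x * (Complex.I * (φ1 x : ℂ))) x := fun x hx =>
    ((h1 x hx).ofReal_comp.const_mul Complex.I).cexp
  have hec : ContinuousOn e U := fun x hx => (hed x hx).continuousAt.continuousWithinAt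
  have hen : ∀ x, ‖e x‖ = 1 := fun x => by
    simp only [he]; rw [mul_comm]; exact Complex.norm_exp_ofReal_mul_I _
  set g : ℝ → ℝ := fun x => φ1 x / (φ1 x ^ 2 + μ) with hg
  have hD : ∀ x, 0 < φ1 x ^ 2 + μ := fun x => by positivity
  have hgd : ∀ x ∈ U, HasDerivAt g (φ2 x * (μ - φ1 x ^ 2) / (φ1 x ^ 2 + μ) ^ 2) x := by
    intro x hx
    have := (h2 x hx).div (((h2 x hx).pow 2).add_const μ) (hD x).ne'
    refine this.congr_deriv ?_
    congr 1
    simp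
    ring
  set F : ℝ → ℂ := fun x => -Complex.I * (g x : ℂ) * e x with hF
  have hgn : ∀ x, |g x| ≤ 1 / (2 * s) := by
    intro x
    rw [hg]
    simp only
    rw [abs_div, abs_of_pos (hD x), div_le_div_iff₀ (hD x) (by positivity)]
    nlinarith [sq_nonneg (|φ1 x| - s), sq_abs (φ1 x)]
  have hFn : ∀ x, ‖F x‖ ≤ 1 / (2 * s) := by
    intro x
    simp only [hF, norm_mul, hen, norm_neg, Complex.norm_I, Complex.norm_real, one_mul, mul_one]
    exact hgn x
  set G : ℝ → ℂ := fun x => (∫ y in a..x, e y) - F x + F a with hG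
  set G' : ℝ → ℂ := fun x => e x * ((μ / (φ1 x ^ 2 + μ) : ℝ) +
      Complex.I * ((φ2 x * (μ - φ1 x ^ 2) / (φ1 x ^ 2 + μ) ^ 2 : ℝ) : ℂ)) with hG'
  have hGd : ∀ x ∈ Set.Icc a b, HasDerivAt G (G' x) x := by
    intro x hx
    have hxU := hsub hx
    have i1 : HasDerivAt (fun x => ∫ y in a..x, e y) (e x) x := by
      apply intervalIntegral.integral_hasDerivAt_right
      · apply ContinuousOn.intervalIntegrable
        rw [Set.uIcc_of_le hx.1]
        exact hec.mono ((Set.Icc_subset_Icc_right hx.2).trans hsub)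
      · exact hec.stronglyMeasurableAtFilter hU x hxU
      · exact (hed x hxU).continuousAt
    have i2 : HasDerivAt F _ x := (((hgd x hxU).ofReal_comp.const_mul (-Complex.I)).mul (hed x hxU))
    refine ((i1.sub i2).add_const (F a)).congr_deriv ?_
    have hDc : ((φ1 x : ℂ) ^ 2 + μ) ≠ 0 := by exact_mod_cast (hD x).ne'
    simp only [hG', hg]
    push_cast
    field_simp
    ring_nf
    simp only [Complex.I_sq]
    ring
  set B : ℝ → ℝ := fun x => (2 / s) * (Real.arctan (φ1 x / s) - Real.arctan (φ1 a / s)) with hB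
  have hBd : ∀ x ∈ Set.Icc a b, HasDerivAt B (2 * φ2 x / (φ1 x ^ 2 + μ)) x := by
    intro x hx
    refine (((((h2 x (hsub hx)).div_const s).arctan).sub_const _).const_mul (2 / s)).congr_deriv ?_
    have := (hD x).ne'
    rw [← hs2] at this ⊢
    have h' : 1 + (φ1 x / s) ^ 2 ≠ 0 := by positivity
    field_simp
    ring
  have key : ‖G b‖ ≤ B b := by
    refine image_norm_le_of_norm_deriv_right_le_deriv_boundary' (f := G) (f' := G') (B := B)
      (B' := fun x => 2 * φ2 x / (φ1 x ^ 2 + μ))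
      (fun x hx => (hGd x hx).continuousAt.continuousWithinAt)
      (fun x hx => (hGd x (Set.Ico_subset_Icc_self hx)).hasDerivWithinAt) ?_
      (fun x hx => (hBd x hx).continuousAt.continuousWithinAt)
      (fun x hx => (hBd x (Set.Ico_subset_Icc_self hx)).hasDerivWithinAt) ?_ (Set.right_mem_Icc.2 hab)
    · simp [hG, hB]
    · intro x hx
      have h3x := h3 x (Set.Ico_subset_Icc_self hx)
      simp only [hG', norm_mul, hen, one_mul]
      refine (norm_add_le _ _).trans ?_
      rw [norm_mul, Complex.norm_I, one_mul, Complex.norm_real, Complex.norm_real,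
        Real.norm_eq_abs, Real.norm_eq_abs, abs_div, abs_div, abs_of_pos hμ, abs_of_pos (hD x),
        abs_mul, abs_of_pos (hμ.trans_le h3x), abs_of_pos (pow_pos (hD x) 2)]
      have : |μ - φ1 x ^ 2| ≤ φ1 x ^ 2 + μ := by
        rw [abs_le]; constructor <;> nlinarith [sq_nonneg (φ1 x)]
      calc μ / (φ1 x ^ 2 + μ) + φ2 x * |μ - φ1 x ^ 2| / (φ1 x ^ 2 + μ) ^ 2
          ≤ φ2 x / (φ1 x ^ 2 + μ) + φ2 x * (φ1 x ^ 2 + μ) / (φ1 x ^ 2 + μ) ^ 2 := by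
            have := hD x
            have := hμ.trans_le h3x
            gcongr
        _ = 2 * φ2 x / (φ1 x ^ 2 + μ) := by
            have := (hD x).ne'
            field_simp
            ring
  have hBb : B b ≤ 2 * π / s := by
    simp only [hB]
    rw [div_mul_eq_mul_div]
    gcongr
    linarith [Real.arctan_lt_pi_div_two (φ1 b / s), Real.neg_pi_div_two_lt_arctan (φ1 a / s)]
  have : (∫ x in a..b, e x) = G b + F b - F a := by simp only [hG]; ring
  rw [this]
  have h4 := hFn a
  have h5 := hFn b
  calc ‖G b + F b - F a‖ ≤ ‖G b‖ + ‖F b‖ + ‖F a‖ :=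
        (norm_sub_le _ _).trans (by gcongr; exact norm_add_le _ _)
    _ ≤ 2 * π / s + 1 / (2 * s) + 1 / (2 * s) := by gcongr; exact key.trans hBb
    _ = (2 * π + 1) / s := by field_simp; ring
    _ ≤ 8 / s := by gcongr; linarith [Real.pi_lt_d2]

/-- The phase function. -/
noncomputable def phs (t : ℝ) (n : ℕ) (θ : ℝ) : ℝ :=
  (t / 2) * (Real.cos (θ / 2) / Real.sin (θ / 2)) + n * θ

lemma phs_meas (t : ℝ) (n : ℕ) : Measurable (phs t n) := by
  unfold phs; fun_prop

lemma phs_int (t : ℝ) (n : ℕ) (c : ℂ) (hc : c = Complex.I ∨ c = -Complex.I) (a b : ℝ) :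
    IntervalIntegrable (fun θ => Complex.exp (c * (phs t n θ : ℂ))) volume a b := by
  have hm := phs_meas t n
  refine (intervalIntegrable_const (c := (1:ℝ))).mono_fun ?_ ?_
  · refine Measurable.aestronglyMeasurable ?_
    fun_prop
  · refine Filter.Eventually.of_forall fun θ => ?_
    rcases hc with rfl | rfl <;> simp [Complex.norm_exp]

lemma phs_half (t : ℝ) (ht : 0 < t) (n : ℕ) :
    ‖∫ θ in (0:ℝ)..π, Complex.exp (Complex.I * (phs t n θ : ℂ))‖ ≤ 34 * t ^ (-(1:ℝ) / 3) := by
  set δ := t ^ (-(1:ℝ) / 3) with hδ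
  have hδ0 : 0 < δ := by positivity
  have hδ3 : t * δ ^ 3 = 1 := by
    rw [hδ, ← Real.rpow_natCast, ← Real.rpow_mul ht.le]
    norm_num
    rw [Real.rpow_neg_one]
    field_simp
  have triv : ∀ a b : ℝ, a ≤ b →
      ‖∫ θ in a..b, Complex.exp (Complex.I * (phs t n θ : ℂ))‖ ≤ b - a := by
    intro a b hab
    have := intervalIntegral.norm_integral_le_of_norm_le_const (a := a) (b := b) (C := 1)
      (f := fun θ => Complex.exp (Complex.I * (phs t n θ : ℂ)))
      (fun θ _ => by simp [Complex.norm_exp])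
    rwa [one_mul, abs_of_nonneg (by linarith)] at this
  have hpi := Real.pi_gt_three
  have hpi4 := Real.pi_lt_four
  rcases le_or_gt 1 δ with h | h
  · refine (triv 0 π Real.pi_pos.le).trans ?_
    linarith
  have ii := phs_int t n Complex.I (Or.inl rfl)
  rw [← intervalIntegral.integral_add_adjacent_intervals (ii 0 δ) (ii δ π),
    ← intervalIntegral.integral_add_adjacent_intervals (ii δ (π - δ)) (ii (π - δ) π)]
  have e1 := triv 0 δ hδ0.le
  have e3 := triv (π - δ) π (by linarith)
  have hsin : ∀ x ∈ Set.Ioo (0:ℝ) (2 * π), 0 < Real.sin (x / 2) := fun x hx =>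
    Real.sin_pos_of_pos_of_lt_pi (by linarith [hx.1]) (by linarith [hx.2])
  have e2 : ‖∫ θ in δ..(π - δ), Complex.exp (Complex.I * (phs t n θ : ℂ))‖ ≤
      8 / √(1 / (4 * δ) ^ 2) := by
    refine vdc2 (phs t n) (fun θ => n - t / (4 * Real.sin (θ / 2) ^ 2))
      (fun θ => t * Real.cos (θ / 2) / (4 * Real.sin (θ / 2) ^ 3))
      (Set.Ioo 0 (2 * π)) isOpen_Ioo δ (π - δ) _ (by linarith)
      (fun x hx => ⟨by linarith [hx.1], by linarith [hx.2]⟩) (by positivity) ?_ ?_ ?_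
    · intro x hx
      have hs := (hsin x hx).ne'
      have hh : HasDerivAt (fun x : ℝ => x / 2) (1 / 2) x := (hasDerivAt_id x).div_const 2
      have := ((hh.cos.div hh.sin hs).const_mul (t / 2)).add ((hasDerivAt_id x).const_mul (n:ℝ))
      refine this.congr_deriv ?_
      have h2 := Real.sin_sq_add_cos_sq (x / 2)
      field_simp
      linear_combination (-4 * t) * h2
    · intro x hx
      have hs := (hsin x hx).ne'
      have hh : HasDerivAt (fun x : ℝ => x / 2) (1 / 2) x := (hasDerivAt_id x).div_const 2
      have := ((hasDerivAt_const x t).div ((hh.sin.pow 2).const_mul 4)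
        (mul_ne_zero four_ne_zero (pow_ne_zero 2 hs))).const_sub (n:ℝ)
      refine this.congr_deriv ?_
      simp only [Pi.pow_apply]
      field_simp
      norm_num
      left
      ring
    · intro x hx
      have hx0 : x ∈ Set.Ioo (0:ℝ) (2 * π) := ⟨by linarith [hx.1], by linarith [hx.2]⟩
      have hs := hsin x hx0
      have hs1 := Real.sin_le_one (x / 2)
      have hc : Real.cos (x / 2) = Real.sin ((π - x) / 2) := by
        rw [← Real.sin_pi_div_two_sub]; congr 1; ring
      have hj := Real.mul_le_sin (x := (π - x) / 2) (by linarith [hx.2]) (by linarith [hx.1])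
      have hj2 : δ / 4 ≤ Real.cos (x / 2) := by
        rw [hc]
        refine le_trans ?_ hj
        rw [div_mul_div_comm, div_le_div_iff₀ (by norm_num) (by positivity)]
        nlinarith [hx.2]
      have hs3 : Real.sin (x / 2) ^ 3 ≤ 1 := pow_le_one₀ hs.le hs1
      rw [div_le_div_iff₀ (by positivity) (by positivity)]
      have : 1 * (4 * Real.sin (x / 2) ^ 3) ≤ 4 := by linarith
      refine this.trans ?_
      have : t * (δ / 4) * (4 * δ) ^ 2 ≤ t * Real.cos (x / 2) * (4 * δ) ^ 2 := by gcongr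
      nlinarith
  have e2' : 8 / √(1 / (4 * δ) ^ 2) = 32 * δ := by
    rw [Real.sqrt_div zero_le_one, Real.sqrt_sq (by positivity), Real.sqrt_one]
    field_simp
    norm_num
  rw [e2'] at e2
  refine (norm_add_le _ _).trans ?_
  have := norm_add_le (∫ θ in δ..(π - δ), Complex.exp (Complex.I * (phs t n θ : ℂ)))
    (∫ θ in (π - δ)..π, Complex.exp (Complex.I * (phs t n θ : ℂ)))
  linarith

lemma phs_full (t : ℝ) (ht : 0 < t) (n : ℕ) :
    ‖∫ θ in (0:ℝ)..(2 * π), Complex.exp (-Complex.I * (phs t n θ : ℂ))‖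
      ≤ 68 * t ^ (-(1:ℝ) / 3) := by
  have ii := phs_int t n (-Complex.I) (Or.inr rfl)
  have hh := phs_half t ht n
  rw [← intervalIntegral.integral_add_adjacent_intervals (ii 0 π) (ii π (2 * π))]
  have h1 : (∫ θ in (0:ℝ)..π, Complex.exp (-Complex.I * (phs t n θ : ℂ))) =
      (starRingEnd ℂ) (∫ θ in (0:ℝ)..π, Complex.exp (Complex.I * (phs t n θ : ℂ))) := by
    rw [intervalIntegral.integral_of_le Real.pi_pos.le, intervalIntegral.integral_of_le Real.pi_pos.le,
      ← integral_conj]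
    congr 1
    ext θ
    rw [← Complex.exp_conj]
    simp
  have h2 : (∫ θ in π..(2 * π), Complex.exp (-Complex.I * (phs t n θ : ℂ))) =
      ∫ θ in (0:ℝ)..π, Complex.exp (Complex.I * (phs t n θ : ℂ)) := by
    have := intervalIntegral.integral_comp_sub_left (a := 0) (b := π)
      (fun θ => Complex.exp (-Complex.I * (phs t n θ : ℂ))) (2 * π)
    rw [show 2 * π - π = π by ring, sub_zero] at this
    rw [← this]
    congr 1
    ext θ
    have e : phs t n (2 * π - θ) = n * (2 * π) - phs t n θ := by
      unfold phs
      rw [show (2 * π - θ) / 2 = π - θ / 2 by ring, Real.cos_pi_sub, Real.sin_pi_sub]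
      ring
    rw [e]
    rw [Complex.exp_eq_exp_iff_exists_int]
    refine ⟨-n, ?_⟩
    push_cast
    ring
  rw [h1, h2]
  refine (norm_add_le _ _).trans ?_
  rw [RCLike.norm_conj]
  linarith

/-- The generating function, normalized. -/
noncomputable def gf (T : ℝ) (z : ℂ) : ℂ := Complex.exp (-((T:ℂ) / 2) * ((1 + z) / (1 - z)))

lemma gf_deriv (T : ℝ) (z : ℂ) (hz : 1 - z ≠ 0) :
    HasDerivAt (gf T) (gf T z * (-(T:ℂ) / (1 - z) ^ 2)) z := by
  have h1 : HasDerivAt (fun z : ℂ => (1 + z) / (1 - z)) _ z :=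
    ((hasDerivAt_id z).const_add 1).div ((hasDerivAt_id z).const_sub 1) hz
  have := (h1.const_mul (-((T:ℂ) / 2))).cexp
  refine this.congr_deriv ?_
  unfold gf
  simp only [id]
  field_simp
  ring

lemma gf_norm (T : ℝ) (hT : 0 < T) (z : ℂ) (hz : ‖z‖ ≤ 1) : ‖gf T z‖ ≤ 1 := by
  unfold gf
  rw [Complex.norm_exp, Real.exp_le_one_iff]
  have h1 : 0 ≤ ((1 + z) / (1 - z)).re := by
    rw [Complex.div_re, ← add_div]
    apply div_nonneg _ (Complex.normSq_nonneg _)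
    have : z.re ^ 2 + z.im ^ 2 ≤ 1 := by
      have := Complex.sq_norm z
      rw [Complex.normSq_apply] at this
      nlinarith [norm_nonneg z]
    simp
    nlinarith
  have h2 : (-((T:ℂ) / 2) * ((1 + z) / (1 - z))).re = -(T / 2) * ((1 + z) / (1 - z)).re := by
    rw [show -((T:ℂ) / 2) = ((-(T / 2) : ℝ) : ℂ) by push_cast; ring, Complex.re_ofReal_mul]
  rw [h2]
  nlinarith

lemma one_sub_ne {r : ℝ} (h1 : r < 1) {z : ℂ} (hz : ‖z‖ ≤ r) : 1 - z ≠ 0 := by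
  intro h
  rw [sub_eq_zero] at h
  rw [← h] at hz
  simp at hz
  linarith

/-- Cauchy integrals. -/
noncomputable def cq (T r : ℝ) (m : ℤ) : ℂ := ∮ z in C(0, r), gf T z * z ^ (-m - 1)

lemma cq_int (T r : ℝ) (h0 : 0 < r) (h1 : r < 1) (m : ℤ) :
    CircleIntegrable (fun z => gf T z * z ^ m) 0 r := by
  apply ContinuousOn.circleIntegrable h0.le
  intro z hz
  have hz' : ‖z‖ = r := by simpa using hz
  have hz0 : z ≠ 0 := by rintro rfl; simp at hz'; linarith
  exact ((gf_deriv T z (one_sub_ne h1 hz'.le)).continuousAt.mul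
    (continuousAt_zpow₀ z m (Or.inl hz0))).continuousWithinAt

lemma cq_rec (T r : ℝ) (h0 : 0 < r) (h1 : r < 1) (m : ℤ) :
    (m:ℂ) * cq T r m = (2 * m - 2 - T) * cq T r (m - 1) - (m - 2) * cq T r (m - 2) := by
  have key : (∮ z in C(0, r), ((2 * m - 2 - T : ℂ) * (gf T z * z ^ (-(m-1) - 1)) -
      (m - 2 : ℂ) * (gf T z * z ^ (-(m-2) - 1)) - (m:ℂ) * (gf T z * z ^ (-m - 1)))) = 0 := by
    apply circleIntegral.integral_eq_zero_of_hasDerivWithinAt h0.le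
      (f := fun z => gf T z * (1 - z) ^ 2 * z ^ (-m))
    intro z hz
    have hz' : ‖z‖ = r := by simpa using hz
    have hz0 : z ≠ 0 := by rintro rfl; simp at hz'; linarith
    have h1z := one_sub_ne h1 hz'.le
    have := ((gf_deriv T z h1z).mul (((hasDerivAt_id z).const_sub 1).pow 2)).mul
      (hasDerivAt_zpow (-m) z (Or.inl hz0))
    refine (this.congr_deriv ?_).hasDerivWithinAt
    have e0 : z ^ (-m) = z * z ^ (-m - 1) := by
      rw [← zpow_one_add₀ hz0]; congr 1; ring
    have e1 : z ^ (-(m-1) - 1) = z * z ^ (-m - 1) := by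
      rw [← zpow_one_add₀ hz0]; congr 1; ring
    have e2 : z ^ (-(m-2) - 1) = z ^ 2 * z ^ (-m - 1) := by
      rw [pow_two, mul_assoc, ← zpow_one_add₀ hz0, ← zpow_one_add₀ hz0]; congr 1; ring
    rw [e0, e1, e2]
    simp only [Pi.mul_apply, Pi.pow_apply, id]
    generalize z ^ (-m - 1) = w
    field_simp
    push_cast
    ring
  have i := cq_int T r h0 h1
  have c1 : CircleIntegrable (fun z => (2 * m - 2 - T : ℂ) * (gf T z * z ^ (-(m-1) - 1))) 0 r :=
    (i _).const_smul
  have c2 : CircleIntegrable (fun z => (m - 2 : ℂ) * (gf T z * z ^ (-(m-2) - 1))) 0 r :=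
    (i _).const_smul
  have c3 : CircleIntegrable (fun z => (m : ℂ) * (gf T z * z ^ (-m - 1))) 0 r :=
    (i _).const_smul
  have c12 : CircleIntegrable (fun z => (2 * m - 2 - T : ℂ) * (gf T z * z ^ (-(m-1) - 1)) -
      (m - 2 : ℂ) * (gf T z * z ^ (-(m-2) - 1))) 0 r := c1.sub c2
  rw [circleIntegral.integral_sub c12 c3, circleIntegral.integral_sub c1 c2,
    circleIntegral.integral_const_mul, circleIntegral.integral_const_mul,
    circleIntegral.integral_const_mul] at key
  unfold cq
  linear_combination -key

lemma gf_diff (T r : ℝ) (h1 : r < 1) : DifferentiableOn ℂ (gf T) (Metric.closedBall 0 r) := by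
  intro z hz
  exact (gf_deriv T z (one_sub_ne h1 (by simpa using hz))).differentiableAt.differentiableWithinAt

lemma cq_neg_one (T r : ℝ) (h0 : 0 < r) (h1 : r < 1) : cq T r (-1) = 0 := by
  unfold cq
  norm_num
  have := (gf_diff T r h1).diffContOnCl_ball (U := Metric.closedBall 0 r) subset_rfl
  exact this.circleIntegral_eq_zero h0.le

lemma cq_zero (T r : ℝ) (h0 : 0 < r) (h1 : r < 1) :
    cq T r 0 = 2 * π * Complex.I * (Real.exp (-T / 2) : ℝ) := by
  unfold cq
  have := (gf_diff T r h1).diffContOnCl_ball (U := Metric.closedBall 0 r) subset_rfl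
  have := this.circleIntegral_sub_inv_smul (w := 0) (by simpa using h0)
  simp only [sub_zero, smul_eq_mul] at this
  simp only [neg_zero, zero_sub, zpow_neg_one]
  simp_rw [mul_comm (gf T _)]
  rw [this]
  unfold gf
  push_cast
  congr 2
  simp
  ring

lemma cq_coeff (T r : ℝ) (h0 : 0 < r) (h1 : r < 1) (F : PowerSeries ℝ)
    (hF0 : PowerSeries.constantCoeff F = 1)
    (hode : (1 - PowerSeries.X) ^ 2 * PowerSeries.derivative ℝ F = -(PowerSeries.C T * F)) (n : ℕ) :
    cq T r n = 2 * π * Complex.I * (Real.exp (-T / 2) : ℝ) * (PowerSeries.coeff n F : ℝ) := by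
  have hode' : PowerSeries.derivative ℝ F - (2:ℝ) • (PowerSeries.X * PowerSeries.derivative ℝ F) +
      PowerSeries.X * (PowerSeries.X * PowerSeries.derivative ℝ F) = -(PowerSeries.C T * F) := by
    rw [← hode, PowerSeries.smul_eq_C_mul]
    rw [show PowerSeries.C (2:ℝ) = 2 from map_ofNat _ 2]
    ring
  have hc := fun k => congrArg (PowerSeries.coeff k) hode'
  simp only [map_add, map_sub, map_neg, PowerSeries.coeff_C_mul, map_smul, smul_eq_mul] at hc
  have hz : PowerSeries.coeff 0 F = 1 := by simpa using hF0
  have r0 : PowerSeries.coeff 1 F = -T := by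
    have := hc 0
    simpa [PowerSeries.coeff_derivative, hF0] using this
  have hstep : ∀ n : ℕ, cq T r n = 2 * π * Complex.I * (Real.exp (-T / 2) : ℝ) * (PowerSeries.coeff n F : ℝ) ∧
     cq T r (n + 1 : ℕ) = 2 * π * Complex.I * (Real.exp (-T / 2) : ℝ) * (PowerSeries.coeff (n + 1) F : ℝ) := by
    intro n
    induction n with
    | zero =>
      constructor
      · rw [hz]; simpa using cq_zero T r h0 h1
      · have := cq_rec T r h0 h1 1
        norm_num [cq_neg_one T r h0 h1] at this
        simp only [zero_add, r0, Nat.cast_one, this, cq_zero T r h0 h1]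
        push_cast
        ring
    | succ n ih =>
      refine ⟨ih.2, ?_⟩
      have h := cq_rec T r h0 h1 ((n + 1 + 1 : ℕ) : ℤ)
      rw [show ((n + 1 + 1 : ℕ) : ℤ) - 1 = (n + 1 : ℕ) by push_cast; ring,
        show ((n + 1 + 1 : ℕ) : ℤ) - 2 = n by push_cast; ring, ih.1, ih.2] at h
      have h' := hc (n + 1)
      have : PowerSeries.coeff (n + 1) (PowerSeries.X * (PowerSeries.X * PowerSeries.derivative ℝ F))
          = n * PowerSeries.coeff n F := by
        rw [PowerSeries.coeff_succ_X_mul]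
        cases n with
        | zero => simp
        | succ k =>
          rw [PowerSeries.coeff_succ_X_mul, PowerSeries.coeff_derivative]; push_cast; ring
      rw [this, PowerSeries.coeff_succ_X_mul, PowerSeries.coeff_derivative,
        PowerSeries.coeff_derivative] at h'
      have hne : ((n:ℂ) + 2) ≠ 0 := by exact_mod_cast (by positivity : (n:ℝ) + 2 ≠ 0)
      have h'' := congrArg (fun x : ℝ => (x : ℂ)) h'
      push_cast at h h''
      apply mul_left_cancel₀ hne
      push_cast
      linear_combination h - (2 * π * Complex.I * Complex.exp (-(T:ℂ) / 2)) * h''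
  exact (hstep n).1

lemma cq_eq (T r : ℝ) (h0 : 0 < r) (n : ℕ) :
    cq T r n = Complex.I * ∫ θ in (0:ℝ)..(2 * π),
      gf T (circleMap 0 r θ) * ((circleMap 0 r θ) ^ n)⁻¹ := by
  unfold cq circleIntegral
  rw [← intervalIntegral.integral_const_mul]
  congr 1
  ext θ
  have hz : circleMap 0 r θ ≠ 0 := circleMap_ne_center h0.ne'
  rw [deriv_circleMap, smul_eq_mul]
  beta_reduce
  rw [zpow_sub₀ hz, zpow_neg, zpow_natCast, zpow_one]
  field_simp

lemma gf_circle (T : ℝ) (n : ℕ) (θ : ℝ) (hθ : Real.sin (θ / 2) ≠ 0) :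
    gf T (circleMap 0 1 θ) * ((circleMap 0 1 θ) ^ n)⁻¹ =
      Complex.exp (-Complex.I * (phs T n θ : ℂ)) := by
  have hz : circleMap 0 1 θ = Complex.exp (θ * Complex.I) := by simp [circleMap]
  rw [hz, ← Complex.exp_nat_mul, ← Complex.exp_neg]
  unfold gf phs
  rw [← Complex.exp_add]
  congr 1
  have hs : (Real.sin (θ / 2) : ℂ) ≠ 0 := by exact_mod_cast hθ
  have e1 : Complex.exp (θ * Complex.I) =
      ((Real.cos (θ / 2) : ℂ) + (Real.sin (θ / 2) : ℂ) * Complex.I) ^ 2 := by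
    push_cast
    rw [← Complex.exp_mul_I, ← Complex.exp_nat_mul]
    congr 1
    push_cast; ring
  have hsc : (Real.sin (θ / 2) : ℂ) ^ 2 + (Real.cos (θ / 2) : ℂ) ^ 2 = 1 := by
    exact_mod_cast Real.sin_sq_add_cos_sq (θ / 2)
  have e2 : (1 + Complex.exp (θ * Complex.I)) / (1 - Complex.exp (θ * Complex.I)) =
      Complex.I * ((Real.cos (θ / 2) : ℂ) / (Real.sin (θ / 2) : ℂ)) := by
    rw [e1]
    set s := (Real.sin (θ / 2) : ℂ)
    set c := (Real.cos (θ / 2) : ℂ)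
    have hd : 1 - (c + s * Complex.I) ^ 2 = -(2 * Complex.I * s) * (c + s * Complex.I) := by
      linear_combination (-1) * hsc + s ^ 2 * Complex.I_sq
    have hu : (c + s * Complex.I) ≠ 0 := by
      intro h
      have : (c + s * Complex.I) * (c - s * Complex.I) = 1 := by
        linear_combination hsc - s ^ 2 * Complex.I_sq
      rw [h] at this; simp at this
    have hn : 1 + (c + s * Complex.I) ^ 2 = (2 * c) * (c + s * Complex.I) := by
      linear_combination (-1) * hsc + s ^ 2 * Complex.I_sq
    rw [hd, hn]
    have := Complex.I_ne_zero
    field_simp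
    linear_combination (-c) * Complex.I_sq
  rw [e2]
  push_cast
  ring

lemma coeff_bound (T : ℝ) (hT : 0 < T) (F : PowerSeries ℝ)
    (hF0 : PowerSeries.constantCoeff F = 1)
    (hode : (1 - PowerSeries.X) ^ 2 * PowerSeries.derivative ℝ F = -(PowerSeries.C T * F)) (n : ℕ) :
    Real.exp (-T / 2) * |PowerSeries.coeff n F| ≤ 12 * T ^ (-(1:ℝ) / 3) := by
  have hpi := Real.pi_gt_three
  set K : ℂ := 2 * π * Complex.I * (Real.exp (-T / 2) : ℝ) * (PowerSeries.coeff n F : ℝ) with hK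
  have hlim : Tendsto (fun r : ℝ => ∫ θ in (0:ℝ)..(2 * π),
      gf T (circleMap 0 r θ) * ((circleMap 0 r θ) ^ n)⁻¹) (nhdsWithin 1 (Set.Iio 1))
      (nhds (∫ θ in (0:ℝ)..(2 * π), Complex.exp (-Complex.I * (phs T n θ : ℂ)))) := by
    have hev : ∀ᶠ r : ℝ in nhdsWithin 1 (Set.Iio 1), 1 / 2 < r ∧ r < 1 := by
      have h1 : ∀ᶠ r : ℝ in nhdsWithin 1 (Set.Iio 1), 1 / 2 < r :=
        nhdsWithin_le_nhds (lt_mem_nhds (by norm_num))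
      exact h1.and self_mem_nhdsWithin
    apply intervalIntegral.tendsto_integral_filter_of_dominated_convergence (fun _ => (2:ℝ) ^ n)
    · filter_upwards [hev] with r hr
      refine Continuous.aestronglyMeasurable ?_
      rw [continuous_iff_continuousAt]
      intro θ
      have hz : circleMap 0 r θ ≠ 0 := circleMap_ne_center (by linarith)
      have hc : ContinuousAt (circleMap 0 r) θ := (continuous_circleMap 0 r).continuousAt
      have h2 : ContinuousAt (gf T) (circleMap 0 r θ) :=
        (gf_deriv T _ (one_sub_ne hr.2 (by simp [abs_of_pos (show 0 < r by linarith)]))).continuousAt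
      exact (h2.comp hc).mul ((hc.pow n).inv₀ (pow_ne_zero n hz))
    · filter_upwards [hev] with r hr
      refine Filter.Eventually.of_forall fun θ _ => ?_
      have hr0 : 0 < r := by linarith
      have hn : ‖circleMap 0 r θ‖ = r := by simp [abs_of_pos hr0]
      rw [norm_mul, norm_inv, norm_pow, hn]
      have h3 : (r ^ n)⁻¹ ≤ 2 ^ n := by
        rw [← inv_pow]
        apply pow_le_pow_left₀ (by positivity)
        rw [inv_le_comm₀ hr0 (by norm_num)]
        linarith
      calc _ ≤ 1 * (2:ℝ) ^ n := by
            gcongr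
            exact gf_norm T hT _ (hn.le.trans hr.2.le)
        _ = _ := one_mul _
    · exact intervalIntegrable_const
    · have hne : ∀ᵐ θ : ℝ, θ ≠ 2 * π := Measure.ae_ne volume _
      filter_upwards [hne] with θ hθ hmem
      rw [Set.uIoc_of_le (by positivity)] at hmem
      have hlt : θ < 2 * π := lt_of_le_of_ne hmem.2 hθ
      have hs : 0 < Real.sin (θ / 2) :=
        Real.sin_pos_of_pos_of_lt_pi (by linarith [hmem.1]) (by linarith)
      rw [← gf_circle T n θ hs.ne']
      have hz : circleMap 0 1 θ ≠ 0 := circleMap_ne_center one_ne_zero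
      have h1z : 1 - circleMap 0 1 θ ≠ 0 := by
        intro h
        have h2 : (circleMap 0 1 θ).re = 1 := by rw [← sub_eq_zero.1 h]; simp
        have h3 : (circleMap 0 1 θ).re = Real.cos θ := by
          simp [circleMap, Complex.exp_ofReal_mul_I_re]
        have h4 : Real.cos θ = 1 - 2 * Real.sin (θ / 2) ^ 2 := by
          have := Real.cos_two_mul (θ / 2)
          rw [show 2 * (θ / 2) = θ by ring] at this
          have := Real.sin_sq_add_cos_sq (θ / 2)
          linarith
        nlinarith
      have hc : ContinuousAt (fun r : ℝ => circleMap 0 r θ) 1 := by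
        unfold circleMap; fun_prop
      have h2 : ContinuousAt (gf T) (circleMap 0 1 θ) := (gf_deriv T _ h1z).continuousAt
      have h3 : ContinuousAt (fun r : ℝ => gf T (circleMap 0 r θ)) 1 :=
        ContinuousAt.comp (f := fun r : ℝ => circleMap 0 r θ) h2 hc
      have := h3.mul ((hc.pow n).inv₀ (pow_ne_zero n hz))
      exact this.tendsto.mono_left nhdsWithin_le_nhds
  have hconst : ∀ᶠ r : ℝ in nhdsWithin 1 (Set.Iio 1), Complex.I * (∫ θ in (0:ℝ)..(2 * π),
      gf T (circleMap 0 r θ) * ((circleMap 0 r θ) ^ n)⁻¹) = K := by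
    have h1 : ∀ᶠ r : ℝ in nhdsWithin 1 (Set.Iio 1), 1 / 2 < r :=
      nhdsWithin_le_nhds (lt_mem_nhds (by norm_num))
    filter_upwards [h1, self_mem_nhdsWithin] with r hr hr1
    rw [← cq_eq T r (by linarith) n]
    exact cq_coeff T r (by linarith) hr1 F hF0 hode n
  have heq : Complex.I * (∫ θ in (0:ℝ)..(2 * π), Complex.exp (-Complex.I * (phs T n θ : ℂ))) = K :=
    tendsto_nhds_unique (hlim.const_mul Complex.I) (tendsto_const_nhds.congr' (hconst.mono fun _ h => h.symm))
  have hb := phs_full T hT n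
  have hKn : ‖K‖ = 2 * π * (Real.exp (-T / 2) * |PowerSeries.coeff n F|) := by
    rw [hK]
    simp only [norm_mul, Complex.norm_real, Complex.norm_I, Real.norm_eq_abs, Complex.norm_ofNat,
      abs_of_pos Real.pi_pos, abs_of_pos (Real.exp_pos _)]
    ring
  rw [← heq, norm_mul, Complex.norm_I, one_mul] at hKn
  rw [hKn] at hb
  have h0 : 0 ≤ Real.exp (-T / 2) * |PowerSeries.coeff n F| := by positivity
  have h1 : 0 < T ^ (-(1:ℝ) / 3) := by positivity
  nlinarith

/-- Laguerre pair `(L_n(t), L_n^{(1)}(t))`. -/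
noncomputable def lagLM (t : ℝ) : ℕ → ℝ × ℝ
  | 0 => (1, 1)
  | n + 1 => ((lagLM t n).1 - t / (n + 1) * (lagLM t n).2,
      (lagLM t n).2 + ((lagLM t n).1 - t / (n + 1) * (lagLM t n).2))

/-- Laguerre polynomial values. -/
noncomputable def lagL (t : ℝ) (n : ℕ) : ℝ := (lagLM t n).1
/-- Associated Laguerre polynomial values. -/
noncomputable def lagM (t : ℝ) (n : ℕ) : ℝ := (lagLM t n).2

lemma lagL_zero (t : ℝ) : lagL t 0 = 1 := rfl
lemma lagM_zero (t : ℝ) : lagM t 0 = 1 := rfl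
lemma lagL_succ (t : ℝ) (n : ℕ) : lagL t (n + 1) = lagL t n - t / (n + 1) * lagM t n := rfl
lemma lagM_succ (t : ℝ) (n : ℕ) : lagM t (n + 1) = lagM t n + lagL t (n + 1) := rfl

open PowerSeries in
lemma coeff_one_sub_X_mul_succ (P : PowerSeries ℝ) (n : ℕ) :
    coeff (n + 1) ((1 - X) * P) = coeff (n + 1) P - coeff n P := by
  rw [sub_mul, one_mul, map_sub, coeff_succ_X_mul]

open PowerSeries in
lemma lag_ode (t : ℝ) : constantCoeff ((1 - X) * mk (lagL t)) = 1 ∧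
    (1 - X) ^ 2 * derivative ℝ ((1 - X) * mk (lagL t)) = -(C t * ((1 - X) * mk (lagL t))) := by
  constructor
  · simp [lagL_zero]
  have h1 : (1 - X) * mk (lagM t) = mk (lagL t) := by
    ext n
    cases n with
    | zero => simp [lagL_zero, lagM_zero]
    | succ n => rw [coeff_one_sub_X_mul_succ]; simp [lagM_succ]
  have h2 : derivative ℝ ((1 - X) * mk (lagL t)) = -(C t * mk (lagM t)) := by
    ext n
    rw [coeff_derivative, coeff_one_sub_X_mul_succ, map_neg, coeff_C_mul]
    simp only [coeff_mk, lagL_succ]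
    have : (n:ℝ) + 1 ≠ 0 := by positivity
    field_simp
    ring
  rw [h2, ← h1]
  ring

open PowerSeries in
lemma prod_ode {ι : Type*} (s : Finset ι) (t : ι → ℝ) (B : ι → PowerSeries ℝ)
    (h0 : ∀ i, constantCoeff (B i) = 1)
    (h : ∀ i, (1 - X) ^ 2 * derivative ℝ (B i) = -(C (t i) * B i)) :
    constantCoeff (∏ i ∈ s, B i) = 1 ∧
    (1 - X) ^ 2 * derivative ℝ (∏ i ∈ s, B i) = -(C (∑ i ∈ s, t i) * ∏ i ∈ s, B i) := by
  classical
  constructor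
  · simp [map_prod, h0]
  induction s using Finset.induction_on with
  | empty => simp
  | insert a s ha ih =>
    rw [Finset.prod_insert ha, Finset.sum_insert ha, Derivation.leibniz, map_add]
    simp only [smul_eq_mul]
    linear_combination (B a) * ih + (∏ i ∈ s, B i) * h a

open PowerSeries in
lemma deriv_one_sub_pow (k : ℕ) :
    (1 - X) * derivative ℝ ((1 - X : PowerSeries ℝ) ^ k) = -((k : PowerSeries ℝ) * (1 - X) ^ k) := by
  cases k with
  | zero => simp
  | succ k =>
    rw [derivative_pow, map_sub, derivative_one, derivative_X]
    push_cast
    simp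
    ring

open PowerSeries in
lemma lag_bound (T : ℝ) (hT : 0 < T) (F : PowerSeries ℝ) (hF0 : constantCoeff F = 1)
    (hode : (1 - X) ^ 2 * derivative ℝ F = -(C T * F)) (k : ℕ) :
    ∀ P : PowerSeries ℝ, (1 - X) ^ k * P = F → ∀ N : ℕ,
    Real.exp (-T / 2) * |coeff N P| ≤ 12 * (2 * (N + k) / T) ^ k * T ^ (-(1:ℝ) / 3) := by
  induction k with
  | zero =>
    intro P hP N
    rw [pow_zero, one_mul] at hP
    simpa [hP] using coeff_bound T hT F hF0 hode N
  | succ k ih =>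
    intro P hP N
    set Q := (1 - X) * P with hQ
    have hQF : (1 - X) ^ k * Q = F := by rw [← hP, hQ]; ring
    have ihQ := ih Q hQF
    have hne : (1 - X : PowerSeries ℝ) ^ (k + 1) ≠ 0 := by
      apply pow_ne_zero
      intro h
      have := congrArg constantCoeff h
      simp at this
    have hrel : C T * P = (k : PowerSeries ℝ) * Q - (derivative ℝ Q - X * derivative ℝ Q) := by
      apply mul_left_cancel₀ hne
      have h1 := hode
      rw [← hQF, Derivation.leibniz] at h1
      simp only [smul_eq_mul] at h1
      have h2 := deriv_one_sub_pow k
      linear_combination h1 - (1 - X) * Q * h2 - (1 - X) ^ k * C T * hQ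
    have hco : T * coeff N P = (k + N) * coeff N Q - (N + 1) * coeff (N + 1) Q := by
      have := congrArg (coeff N) hrel
      have hX : coeff N (X * derivative ℝ Q) = N * coeff N Q := by
        cases N with
        | zero => simp
        | succ m => rw [coeff_succ_X_mul, coeff_derivative]; push_cast; ring
      rw [coeff_C_mul, map_sub, map_sub, hX, coeff_derivative,
        show (k : PowerSeries ℝ) = C (k:ℝ) by simp, coeff_C_mul] at this
      rw [this]
      ring
    have b1 := ihQ N
    have b2 := ihQ (N + 1)
    set e := Real.exp (-T / 2) with he
    have he0 : 0 < e := Real.exp_pos _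
    set τ := T ^ (-(1:ℝ) / 3) with hτ
    have hτ0 : 0 < τ := by positivity
    set w : ℝ := 2 * ((N:ℝ) + ((k + 1 : ℕ):ℝ)) / T with hw
    have hw0 : 0 ≤ w := by positivity
    have b1' : e * |coeff N Q| ≤ 12 * w ^ k * τ := by
      refine b1.trans ?_
      gcongr
      rw [hw]
      gcongr
      push_cast; linarith
    have b2' : e * |coeff (N + 1) Q| ≤ 12 * w ^ k * τ := by
      refine b2.trans (le_of_eq ?_)
      rw [hw]
      push_cast
      ring_nf
    have h3 : T * |coeff N P| ≤ (k + N) * |coeff N Q| + (N + 1) * |coeff (N + 1) Q| := by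
      have : T * |coeff N P| = |T * coeff N P| := by rw [abs_mul, abs_of_pos hT]
      rw [this, hco]
      refine (abs_sub _ _).trans (le_of_eq ?_)
      rw [abs_mul, abs_mul, abs_of_nonneg (by positivity : (0:ℝ) ≤ k + N),
        abs_of_nonneg (by positivity : (0:ℝ) ≤ N + 1)]
    have hTw : T * w = 2 * (N + k + 1) := by
      rw [hw]; field_simp; push_cast; ring
    have hz : 0 ≤ 12 * w ^ k * τ := by positivity
    have : T * (e * |coeff N P|) ≤ T * (12 * w ^ (k + 1) * τ) := by
      calc T * (e * |coeff N P|) = e * (T * |coeff N P|) := by ring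
        _ ≤ e * ((k + N) * |coeff N Q| + (N + 1) * |coeff (N + 1) Q|) := by gcongr
        _ = (k + N) * (e * |coeff N Q|) + (N + 1) * (e * |coeff (N + 1) Q|) := by ring
        _ ≤ (k + N) * (12 * w ^ k * τ) + (N + 1) * (12 * w ^ k * τ) := by gcongr
        _ ≤ (2 * (N + k + 1)) * (12 * w ^ k * τ) := by
            have : (0:ℝ) ≤ N := by positivity
            have : (0:ℝ) ≤ k := by positivity
            nlinarith
        _ = T * (12 * w ^ (k + 1) * τ) := by rw [← hTw]; ring
    exact le_of_mul_le_mul_left this hT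

lemma lag_sum_bound (d : ℕ) (t : Fin d → ℝ) (T : ℝ) (hT : 0 < T) (hsum : ∑ j, t j = T) (N : ℕ) :
    Real.exp (-T / 2) * |∑ α ∈ Finset.Nat.antidiagonalTuple d N, ∏ j, lagL (t j) (α j)| ≤
      12 * (2 * (N + d) / T) ^ d * T ^ (-(1:ℝ) / 3) := by
  have hp := prod_ode Finset.univ t (fun j => (1 - PowerSeries.X) * PowerSeries.mk (lagL (t j)))
    (fun i => (lag_ode (t i)).1) (fun i => (lag_ode (t i)).2)
  rw [hsum] at hp
  have := lag_bound T hT _ hp.1 hp.2 d (∏ j, PowerSeries.mk (lagL (t j)))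
    (by rw [Finset.prod_mul_distrib]; simp) N
  convert this using 3
  rw [PowerSeries.coeff_prod]
  refine Finset.sum_bij' (fun α _ => Finsupp.equivFunOnFinite.symm α) (fun f _ => f) ?_ ?_ ?_ ?_ ?_
  · intro α hα
    rw [Finset.Nat.mem_antidiagonalTuple] at hα
    simp [Finset.mem_finsuppAntidiag, hα]
  · intro f hf
    rw [Finset.mem_finsuppAntidiag] at hf
    rw [Finset.Nat.mem_antidiagonalTuple]
    exact hf.1
  · intro α _; rfl
  · intro f _; ext; rfl
  · intro α _; simp

lemma physHermite_deriv (n : ℕ) : Polynomial.derivative (physHermite (n + 1)) =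
    2 * ((n + 1 : ℕ) : Polynomial ℝ) * physHermite n := by
  induction n with
  | zero => simp [physHermite]
  | succ n ih =>
    have h1 : physHermite (n + 1) = 2 * Polynomial.X * physHermite n -
      Polynomial.derivative (physHermite n) := rfl
    have h2 : physHermite (n + 1 + 1) = 2 * Polynomial.X * physHermite (n + 1) -
      Polynomial.derivative (physHermite (n + 1)) := rfl
    rw [h2, Polynomial.derivative_sub, ih]
    simp only [Polynomial.derivative_mul, Polynomial.derivative_X, Polynomial.derivative_ofNat,
      Polynomial.derivative_natCast, ih]
    push_cast
    linear_combination (-2 * ((n:Polynomial ℝ) + 1)) * h1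

/-- The Gaussian factor. -/
def gau (ξ v : ℝ) : ℂ := Complex.exp (-(1 / 4 : ℂ) * (v:ℂ) ^ 2 + (-Complex.I * ξ) * v + 0)

lemma gau_norm (ξ v : ℝ) : ‖gau ξ v‖ = Real.exp (-(1 / 4) * v ^ 2) := by
  unfold gau
  rw [Complex.norm_exp]
  congr 1
  have : (-(1 / 4 : ℂ) * (v:ℂ) ^ 2 + (-Complex.I * ξ) * v + 0) =
      ((-(1 / 4) * v ^ 2 : ℝ) : ℂ) + ((-(ξ * v) : ℝ) : ℂ) * Complex.I := by push_cast; ring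
  rw [this, Complex.add_re, Complex.ofReal_re, Complex.re_ofReal_mul, Complex.I_re]
  ring

lemma gau_deriv (ξ v : ℝ) :
    HasDerivAt (gau ξ) (gau ξ v * (-(v:ℂ) / 2 - Complex.I * ξ)) v := by
  have h : HasDerivAt (fun v : ℝ => (v:ℂ)) 1 v := Complex.ofRealCLM.hasDerivAt
  have := ((((h.pow 2).const_mul (-(1 / 4 : ℂ))).add (h.const_mul (-Complex.I * ξ))).add_const 0).cexp
  refine this.congr_deriv ?_
  unfold gau
  congr 1
  simp
  ring

lemma poly_gau_real (P : Polynomial ℝ) :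
    Integrable (fun v : ℝ => P.eval v * Real.exp (-(1 / 4) * v ^ 2)) := by
  induction P using Polynomial.induction_on' with
  | add p q hp hq =>
    simp only [Polynomial.eval_add, add_mul]
    exact hp.add hq
  | monomial n a =>
    have := (integrable_rpow_mul_exp_neg_mul_sq (b := 1 / 4) (by norm_num) (s := n)
      (by have : (0:ℝ) ≤ n := by positivity
          linarith)).const_mul a
    simpa [Real.rpow_natCast, mul_assoc] using this

lemma poly_gau (ξ : ℝ) (P : Polynomial ℝ) :
    Integrable (fun v : ℝ => ((P.eval v : ℝ) : ℂ) * gau ξ v) := by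
  refine (poly_gau_real P).norm.mono' ?_ ?_
  · apply Continuous.aestronglyMeasurable
    have := P.continuous
    unfold gau
    fun_prop
  · refine Filter.Eventually.of_forall fun v => ?_
    rw [norm_mul, gau_norm, Complex.norm_real, norm_mul, Real.norm_of_nonneg (Real.exp_pos _).le]

/-- The Gaussian functional. -/
def gLam (ξ : ℝ) (P : Polynomial ℝ) : ℂ := ∫ v : ℝ, ((P.eval v : ℝ) : ℂ) * gau ξ v

lemma gLam_add (ξ : ℝ) (P Q : Polynomial ℝ) : gLam ξ (P + Q) = gLam ξ P + gLam ξ Q := by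
  unfold gLam
  rw [← integral_add (poly_gau ξ P) (poly_gau ξ Q)]
  congr 1; ext v; simp; ring

lemma gLam_C (ξ a : ℝ) (P : Polynomial ℝ) : gLam ξ (Polynomial.C a * P) = a * gLam ξ P := by
  unfold gLam
  rw [← integral_const_mul]
  congr 1; ext v; simp; ring

lemma gLam_ibp (ξ : ℝ) (P : Polynomial ℝ) :
    gLam ξ (Polynomial.X * P) = 2 * gLam ξ (Polynomial.derivative P) - 2 * Complex.I * ξ * gLam ξ P := by
  have h : ∫ v : ℝ, (((Polynomial.derivative P).eval v : ℝ) : ℂ) * gau ξ v +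
      ((-1/2 : ℂ) * ((((Polynomial.X * P).eval v : ℝ) : ℂ) * gau ξ v) +
      (-Complex.I * ξ) * (((P.eval v : ℝ) : ℂ) * gau ξ v)) = 0 := by
    apply integral_eq_zero_of_hasDerivAt_of_integrable
      (f := fun v : ℝ => ((P.eval v : ℝ) : ℂ) * gau ξ v)
    · intro v
      refine (((P.hasDerivAt v).ofReal_comp).mul (gau_deriv ξ v)).congr_deriv ?_
      simp
      ring
    · exact (poly_gau ξ _).add (((poly_gau ξ _).const_mul _).add ((poly_gau ξ _).const_mul _))
    · exact poly_gau ξ P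
  have i2 : Integrable (fun v : ℝ => ((-1/2 : ℂ) * ((((Polynomial.X * P).eval v : ℝ) : ℂ) * gau ξ v) +
      (-Complex.I * ξ) * (((P.eval v : ℝ) : ℂ) * gau ξ v))) :=
    ((poly_gau ξ _).const_mul _).add ((poly_gau ξ _).const_mul _)
  rw [integral_add (poly_gau ξ _) i2,
    integral_add ((poly_gau ξ _).const_mul _) ((poly_gau ξ _).const_mul _),
    integral_const_mul, integral_const_mul] at h
  unfold gLam
  linear_combination (-2) * h

lemma gLam_one (ξ : ℝ) : gLam ξ 1 = ((2 * √π * Real.exp (-ξ ^ 2) : ℝ) : ℂ) := by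
  unfold gLam gau
  simp only [Polynomial.eval_one, Complex.ofReal_one, one_mul]
  rw [integral_cexp_quadratic (by norm_num)]
  have h1 : ((π:ℂ) / -(-(1/4))) ^ (1 / 2 : ℂ) = ((2 * √π : ℝ) : ℂ) := by
    rw [show (π:ℂ) / -(-(1/4)) = ((4 * π : ℝ) : ℂ) by push_cast; ring,
      show (1 / 2 : ℂ) = ((1 / 2 : ℝ) : ℂ) by push_cast; ring,
      ← Complex.ofReal_cpow (by positivity), ← Real.sqrt_eq_rpow,
      Real.sqrt_mul (by norm_num), show (4:ℝ) = 2 ^ 2 by norm_num, Real.sqrt_sq (by norm_num)]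
  rw [h1]
  push_cast
  congr 2
  have := Complex.I_sq
  field_simp
  linear_combination ((ξ:ℂ) ^ 2) * this

/-- `H_m(x + v/2)` as a polynomial in `v`. -/
def hA (x : ℝ) (m : ℕ) : Polynomial ℝ :=
  (physHermite m).comp (Polynomial.C x + Polynomial.C (1 / 2) * Polynomial.X)
/-- `H_m(x - v/2)` as a polynomial in `v`. -/
def hB (x : ℝ) (m : ℕ) : Polynomial ℝ :=
  (physHermite m).comp (Polynomial.C x - Polynomial.C (1 / 2) * Polynomial.X)

lemma C_half : (2 : Polynomial ℝ) * Polynomial.C (1 / 2) = 1 := by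
  rw [show (2 : Polynomial ℝ) = Polynomial.C 2 from (map_ofNat _ 2).symm, ← Polynomial.C_mul]
  norm_num

lemma hA_deriv (x : ℝ) (m : ℕ) :
    Polynomial.derivative (hA x (m + 1)) = ((m + 1 : ℕ) : Polynomial ℝ) * hA x m := by
  unfold hA
  rw [Polynomial.derivative_comp, physHermite_deriv]
  simp only [Polynomial.derivative_add, Polynomial.derivative_C, Polynomial.derivative_mul,
    Polynomial.derivative_X, Polynomial.mul_comp, Polynomial.natCast_comp, Polynomial.ofNat_comp]
  linear_combination (((m + 1 : ℕ) : Polynomial ℝ) * (physHermite m).comp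
    (Polynomial.C x + Polynomial.C (1 / 2) * Polynomial.X)) * C_half

lemma hB_deriv (x : ℝ) (m : ℕ) :
    Polynomial.derivative (hB x (m + 1)) = -((m + 1 : ℕ) : Polynomial ℝ) * hB x m := by
  unfold hB
  rw [Polynomial.derivative_comp, physHermite_deriv]
  simp only [Polynomial.derivative_sub, Polynomial.derivative_C, Polynomial.derivative_mul,
    Polynomial.derivative_X, Polynomial.mul_comp, Polynomial.natCast_comp, Polynomial.ofNat_comp]
  linear_combination (-((m + 1 : ℕ) : Polynomial ℝ) * (physHermite m).comp
    (Polynomial.C x - Polynomial.C (1 / 2) * Polynomial.X)) * C_half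

lemma hA_succ (x : ℝ) (m : ℕ) : hA x (m + 1) =
    2 * Polynomial.C x * hA x m + Polynomial.X * hA x m - 2 * Polynomial.derivative (hA x m) := by
  have h1 : physHermite (m + 1) = 2 * Polynomial.X * physHermite m -
      Polynomial.derivative (physHermite m) := rfl
  unfold hA
  rw [h1, Polynomial.derivative_comp]
  simp only [Polynomial.derivative_add, Polynomial.derivative_C, Polynomial.derivative_mul,
    Polynomial.derivative_X, Polynomial.mul_comp, Polynomial.sub_comp, Polynomial.ofNat_comp,
    Polynomial.X_comp]
  linear_combination (Polynomial.X * (physHermite m).comp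
    (Polynomial.C x + Polynomial.C (1 / 2) * Polynomial.X) + (Polynomial.derivative (physHermite m)).comp
    (Polynomial.C x + Polynomial.C (1 / 2) * Polynomial.X)) * C_half

lemma hB_succ (x : ℝ) (m : ℕ) : hB x (m + 1) =
    2 * Polynomial.C x * hB x m - Polynomial.X * hB x m + 2 * Polynomial.derivative (hB x m) := by
  have h1 : physHermite (m + 1) = 2 * Polynomial.X * physHermite m -
      Polynomial.derivative (physHermite m) := rfl
  unfold hB
  rw [h1, Polynomial.derivative_comp]
  simp only [Polynomial.derivative_sub, Polynomial.derivative_C, Polynomial.derivative_mul,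
    Polynomial.derivative_X, Polynomial.mul_comp, Polynomial.sub_comp, Polynomial.ofNat_comp,
    Polynomial.X_comp]
  linear_combination (-Polynomial.X * (physHermite m).comp
    (Polynomial.C x - Polynomial.C (1 / 2) * Polynomial.X) + (Polynomial.derivative (physHermite m)).comp
    (Polynomial.C x - Polynomial.C (1 / 2) * Polynomial.X)) * C_half

lemma J_rec1 (x ξ : ℝ) (m n : ℕ) : gLam ξ (hA x (m + 1) * hB x n) =
    2 * (x - Complex.I * ξ) * gLam ξ (hA x m * hB x n) +
      2 * gLam ξ (hA x m * Polynomial.derivative (hB x n)) := by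
  have e : hA x (m + 1) * hB x n = Polynomial.C (2 * x) * (hA x m * hB x n) +
      (Polynomial.X * (hA x m * hB x n) +
        Polynomial.C (-2) * (Polynomial.derivative (hA x m) * hB x n)) := by
    rw [hA_succ, Polynomial.C_mul, show Polynomial.C (2:ℝ) = 2 from map_ofNat _ 2,
      Polynomial.C_neg, show Polynomial.C (2:ℝ) = 2 from map_ofNat _ 2]
    ring
  rw [e, gLam_add, gLam_add, gLam_C, gLam_C, gLam_ibp, Polynomial.derivative_mul, gLam_add]
  push_cast
  ring

lemma J_rec2 (x ξ : ℝ) (m n : ℕ) : gLam ξ (hA x m * hB x (n + 1)) =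
    2 * (x + Complex.I * ξ) * gLam ξ (hA x m * hB x n) -
      2 * gLam ξ (Polynomial.derivative (hA x m) * hB x n) := by
  have e : hA x m * hB x (n + 1) = Polynomial.C (2 * x) * (hA x m * hB x n) +
      (Polynomial.C (-1) * (Polynomial.X * (hA x m * hB x n)) +
        Polynomial.C 2 * (hA x m * Polynomial.derivative (hB x n))) := by
    rw [hB_succ, Polynomial.C_mul, show Polynomial.C (2:ℝ) = 2 from map_ofNat _ 2,
      Polynomial.C_neg, Polynomial.C_1]
    ring
  rw [e, gLam_add, gLam_add, gLam_C, gLam_C, gLam_C, gLam_ibp, Polynomial.derivative_mul, gLam_add]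
  push_cast
  ring

lemma gLam_nat (ξ : ℝ) (k : ℕ) (P : Polynomial ℝ) : gLam ξ ((k : Polynomial ℝ) * P) = k * gLam ξ P := by
  have := gLam_C ξ k P
  simpa using this

lemma J_diag (x ξ : ℝ) (n : ℕ) :
    gLam ξ (hA x n * hB x n) =
      (-2) ^ n * (n.factorial : ℂ) * (lagL (2 * (x ^ 2 + ξ ^ 2)) n : ℂ) * gLam ξ 1 ∧
    gLam ξ (hA x n * hB x (n + 1)) =
      2 * (x + Complex.I * ξ) * (-2) ^ n * (n.factorial : ℂ) *
        (lagM (2 * (x ^ 2 + ξ ^ 2)) n : ℂ) * gLam ξ 1 := by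
  have hA0 : hA x 0 = 1 := by simp [hA, physHermite]
  have hB0 : hB x 0 = 1 := by simp [hB, physHermite]
  induction n with
  | zero =>
    constructor
    · simp [hA0, hB0, lagL_zero]
    · rw [J_rec2, hA0, hB0]
      simp [lagM_zero, gLam]
  | succ n ih =>
    have hne : ((n:ℂ) + 1) ≠ 0 := by exact_mod_cast (by positivity : (n:ℝ) + 1 ≠ 0)
    have h1 : gLam ξ (hA x (n + 1) * hB x (n + 1)) =
      (-2) ^ (n + 1) * ((n + 1).factorial : ℂ) * (lagL (2 * (x ^ 2 + ξ ^ 2)) (n + 1) : ℂ) *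
        gLam ξ 1 := by
      rw [J_rec1, hB_deriv, show hA x n * (-((n + 1 : ℕ) : Polynomial ℝ) * hB x n) =
        Polynomial.C (-1) * (((n + 1 : ℕ) : Polynomial ℝ) * (hA x n * hB x n)) by simp; ring,
        gLam_C, gLam_nat, ih.1, ih.2, lagL_succ, Nat.factorial_succ]
      push_cast
      field_simp
      linear_combination (-4 * (-2) ^ n * (n.factorial : ℂ) * gLam ξ 1 * (ξ:ℂ) ^ 2 *
        (lagM (2 * (x ^ 2 + ξ ^ 2)) n : ℂ)) * Complex.I_sq
    refine ⟨h1, ?_⟩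
    rw [J_rec2, h1, hA_deriv, mul_assoc ((n + 1 : ℕ) : Polynomial ℝ), gLam_nat, ih.2, lagM_succ, Nat.factorial_succ]
    push_cast
    ring

lemma herm_prod (x v ξ : ℝ) (n : ℕ) :
    ((hermiteFun n (x + v / 2) * hermiteFun n (x - v / 2) : ℝ) : ℂ) *
        Complex.exp (-Complex.I * (v * ξ : ℝ)) =
      ((((2 : ℝ) ^ n * (n.factorial : ℝ) * √π)⁻¹ * Real.exp (-x ^ 2) : ℝ) : ℂ) *
        ((((hA x n * hB x n).eval v : ℝ) : ℂ) * gau ξ v) := by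
  have hpos : 0 < (2 : ℝ) ^ n * (n.factorial : ℝ) * √π := by positivity
  set c := (2 : ℝ) ^ n * (n.factorial : ℝ) * √π with hc
  have hcc : c ^ (-(1:ℝ) / 2) * c ^ (-(1:ℝ) / 2) = c⁻¹ := by
    rw [← Real.rpow_add hpos, ← Real.rpow_neg_one]; norm_num
  have hA' : (hA x n).eval v = (physHermite n).eval (x + v / 2) := by
    unfold hA
    rw [Polynomial.eval_comp]; simp; congr 1; ring
  have hB' : (hB x n).eval v = (physHermite n).eval (x - v / 2) := by
    unfold hB
    rw [Polynomial.eval_comp]; simp; congr 1; ring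
  have hg : gau ξ v = (Real.exp (-v ^ 2 / 4) : ℝ) * Complex.exp (-Complex.I * (v * ξ : ℝ)) := by
    unfold gau
    push_cast
    rw [← Complex.exp_add]
    congr 1
    ring
  have he : Real.exp (-(x + v / 2) ^ 2 / 2) * Real.exp (-(x - v / 2) ^ 2 / 2) =
      Real.exp (-x ^ 2) * Real.exp (-v ^ 2 / 4) := by
    rw [← Real.exp_add, ← Real.exp_add]; congr 1; ring
  rw [hg, Polynomial.eval_mul, hA', hB', ← hcc]
  unfold hermiteFun
  rw [← hc]
  have : (c ^ (-(1:ℝ) / 2) * (physHermite n).eval (x + v / 2) * Real.exp (-(x + v / 2) ^ 2 / 2)) *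
      (c ^ (-(1:ℝ) / 2) * (physHermite n).eval (x - v / 2) * Real.exp (-(x - v / 2) ^ 2 / 2)) =
      c ^ (-(1:ℝ) / 2) * c ^ (-(1:ℝ) / 2) * Real.exp (-x ^ 2) *
        ((physHermite n).eval (x + v / 2) * (physHermite n).eval (x - v / 2)) *
        Real.exp (-v ^ 2 / 4) := by
    linear_combination (c ^ (-(1:ℝ) / 2) * c ^ (-(1:ℝ) / 2) *
        ((physHermite n).eval (x + v / 2) * (physHermite n).eval (x - v / 2))) * he
  rw [this]
  push_cast
  ring

lemma wig1 (x ξ : ℝ) (n : ℕ) :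
    Integrable (fun v : ℝ => ((hermiteFun n (x + v / 2) * hermiteFun n (x - v / 2) : ℝ) : ℂ) *
        Complex.exp (-Complex.I * (v * ξ : ℝ))) ∧
    ∫ v : ℝ, ((hermiteFun n (x + v / 2) * hermiteFun n (x - v / 2) : ℝ) : ℂ) *
        Complex.exp (-Complex.I * (v * ξ : ℝ)) =
      ((2 * (-1) ^ n * Real.exp (-(x ^ 2 + ξ ^ 2)) * lagL (2 * (x ^ 2 + ξ ^ 2)) n : ℝ) : ℂ) := by
  simp_rw [herm_prod]
  refine ⟨(poly_gau ξ _).const_mul _, ?_⟩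
  rw [integral_const_mul]
  have := (J_diag x ξ n).1
  unfold gLam at this
  rw [this]
  have h1 := gLam_one ξ
  unfold gLam at h1
  rw [h1]
  have e1 : Real.exp (-(x ^ 2 + ξ ^ 2)) = Real.exp (-x ^ 2) * Real.exp (-ξ ^ 2) := by
    rw [← Real.exp_add]; congr 1; ring
  rw [e1]
  have hp : √π ≠ 0 := by positivity
  have hf : (n.factorial : ℝ) ≠ 0 := by positivity
  have e2 : ((-2:ℂ)) ^ n = ((((-1) ^ n * 2 ^ n : ℝ)) : ℂ) := by
    push_cast; rw [← mul_pow]; norm_num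
  rw [e2]
  rw [← Complex.ofReal_natCast, ← Complex.ofReal_mul, ← Complex.ofReal_mul, ← Complex.ofReal_mul,
    ← Complex.ofReal_mul]
  congr 1
  field_simp

lemma wig1s (k : ℝ) (hk : 0 < k) (x ξ : ℝ) (n : ℕ) :
    Integrable (fun v : ℝ => ((k * (hermiteFun n (k * (x + v / 2)) *
        hermiteFun n (k * (x - v / 2))) : ℝ) : ℂ) *
        Complex.exp (-Complex.I * (k ^ 2 * (v * ξ) : ℝ))) ∧
    ∫ v : ℝ, ((k * (hermiteFun n (k * (x + v / 2)) * hermiteFun n (k * (x - v / 2))) : ℝ) : ℂ) *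
        Complex.exp (-Complex.I * (k ^ 2 * (v * ξ) : ℝ)) =
      ((2 * (-1) ^ n * Real.exp (-(k ^ 2 * (x ^ 2 + ξ ^ 2))) *
        lagL (2 * (k ^ 2 * (x ^ 2 + ξ ^ 2))) n : ℝ) : ℂ) := by
  obtain ⟨h1, h2⟩ := wig1 (k * x) (k * ξ) n
  set g : ℝ → ℂ := fun v => ((hermiteFun n (k * x + v / 2) * hermiteFun n (k * x - v / 2) : ℝ) : ℂ) *
        Complex.exp (-Complex.I * (v * (k * ξ) : ℝ)) with hg
  have e : (fun v : ℝ => ((k * (hermiteFun n (k * (x + v / 2)) *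
        hermiteFun n (k * (x - v / 2))) : ℝ) : ℂ) *
        Complex.exp (-Complex.I * (k ^ 2 * (v * ξ) : ℝ))) = fun v => (k:ℂ) * g (k * v) := by
    ext v
    simp only [hg]
    rw [show k * (x + v / 2) = k * x + k * v / 2 by ring,
      show k * (x - v / 2) = k * x - k * v / 2 by ring,
      show k ^ 2 * (v * ξ) = k * v * (k * ξ) by ring]
    push_cast
    ring
  rw [e]
  refine ⟨(h1.comp_mul_left' hk.ne').const_mul _, ?_⟩
  rw [integral_const_mul, Measure.integral_comp_mul_left g k, h2, abs_of_pos (inv_pos.2 hk),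
    Complex.real_smul, ← mul_assoc, ← Complex.ofReal_mul, mul_inv_cancel₀ hk.ne',
    show (k * x) ^ 2 + (k * ξ) ^ 2 = k ^ 2 * (x ^ 2 + ξ ^ 2) by ring]
  simp

lemma wigner_eq (d : ℕ) (hb : ℝ) (hhb : 0 < hb) (N : ℕ) (x ξ : Fin d → ℝ) :
    wigner d hb N x ξ = ((((2 * π * hb) ^ d)⁻¹ * (2 ^ d * (-1) ^ N *
      (Real.exp (-(4 * Hfun x ξ / hb) / 2) * ∑ α ∈ Finset.Nat.antidiagonalTuple d N,
        ∏ j, lagL (2 * (1 / hb * (x j ^ 2 + ξ j ^ 2))) (α j))) : ℝ) : ℂ) := by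
  set k := hb ^ (-(1:ℝ) / 2) with hk
  have hk0 : 0 < k := by positivity
  have hk2 : k ^ 2 = 1 / hb := by
    rw [hk, ← Real.rpow_natCast, ← Real.rpow_mul hhb.le]
    norm_num
    rw [Real.rpow_neg_one]
  have hkd : hb ^ (-(d:ℝ) / 4) * hb ^ (-(d:ℝ) / 4) = k ^ d := by
    rw [hk, ← Real.rpow_natCast, ← Real.rpow_mul hhb.le, ← Real.rpow_add hhb]
    congr 1; ring
  have hint : ∀ v : Fin d → ℝ,
      ((projKer d hb N (fun j => x j + v j / 2) (fun j => x j - v j / 2) : ℝ) : ℂ) *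
        Complex.exp (-Complex.I * (dotR v ξ : ℂ) / (hb : ℂ)) =
      ∑ α ∈ Finset.Nat.antidiagonalTuple d N, ∏ j,
        (((k * (hermiteFun (α j) (k * (x j + v j / 2)) *
          hermiteFun (α j) (k * (x j - v j / 2))) : ℝ) : ℂ) *
          Complex.exp (-Complex.I * (k ^ 2 * (v j * ξ j) : ℝ))) := by
    intro v
    have he : Complex.exp (-Complex.I * (dotR v ξ : ℂ) / (hb : ℂ)) =
        ∏ j, Complex.exp (-Complex.I * (k ^ 2 * (v j * ξ j) : ℝ)) := by
      rw [← Complex.exp_sum]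
      congr 1
      rw [← Finset.mul_sum, ← Complex.ofReal_sum, ← Finset.mul_sum, hk2]
      unfold dotR
      push_cast
      ring
    rw [he]
    unfold projKer hermiteProdH hermiteProd
    rw [Complex.ofReal_sum, Finset.sum_mul]
    refine Finset.sum_congr rfl fun α _ => ?_
    rw [Finset.prod_mul_distrib, ← Complex.ofReal_prod, Finset.prod_mul_distrib,
      Finset.prod_mul_distrib]
    congr 2
    rw [Finset.prod_const, Finset.card_univ, Fintype.card_fin, ← hkd]
    ring
  unfold wigner
  simp_rw [hint]
  rw [integral_finset_sum]
  swap
  · intro α _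
    exact Integrable.fintype_prod (f := fun j (w : ℝ) =>
        (((k * (hermiteFun (α j) (k * (x j + w / 2)) *
          hermiteFun (α j) (k * (x j - w / 2))) : ℝ) : ℂ) *
          Complex.exp (-Complex.I * (k ^ 2 * (w * ξ j) : ℝ)))) (μ := fun _ => volume)
      (fun j => (wig1s k hk0 (x j) (ξ j) (α j)).1)
  rw [Complex.ofReal_mul]
  congr 1
  rw [Finset.mul_sum, Finset.mul_sum, Complex.ofReal_sum]
  refine Finset.sum_congr rfl fun α hα => ?_
  rw [integral_fintype_prod_volume_eq_prod (f := fun j (w : ℝ) =>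
        (((k * (hermiteFun (α j) (k * (x j + w / 2)) *
          hermiteFun (α j) (k * (x j - w / 2))) : ℝ) : ℂ) *
          Complex.exp (-Complex.I * (k ^ 2 * (w * ξ j) : ℝ))))]
  simp_rw [(wig1s k hk0 _ _ _).2]
  rw [← Complex.ofReal_prod]
  congr 1
  rw [Finset.Nat.mem_antidiagonalTuple] at hα
  rw [Finset.prod_mul_distrib, Finset.prod_mul_distrib, Finset.prod_mul_distrib,
    Finset.prod_pow_eq_pow_sum, hα, ← Real.exp_sum, Finset.prod_const, Finset.card_univ,
    Fintype.card_fin, hk2]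
  have : ∑ i, -(1 / hb * (x i ^ 2 + ξ i ^ 2)) = -(4 * Hfun x ξ / hb) / 2 := by
    unfold Hfun
    rw [Finset.sum_neg_distrib, ← Finset.mul_sum, Finset.sum_add_distrib]
    field_simp
    ring
  rw [this]
  ring

theorem wigner_sup_bound (d : ℕ) (hd : 1 ≤ d) (E : ℝ) (hE : 0 < E) (ε : ℝ) (hε : 0 < ε) :
    ∃ C : ℝ, 0 < C ∧ ∀ N : ℕ, 1 ≤ N → ∀ hb : ℝ, hb = hPl d E N →
      ∀ x ξ : Fin d → ℝ, ε ≤ Hfun x ξ →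
        ‖wigner d hb N x ξ‖ ≤ C * hb ^ (-(d : ℝ) + 1 / 3) := by
  refine ⟨(π ^ d)⁻¹ * (12 * (E / ε) ^ d * (4 * ε) ^ (-(1:ℝ) / 3)), by positivity, ?_⟩
  intro N hN hb hhb x ξ hH
  have hN1 : (1:ℝ) ≤ N := by exact_mod_cast hN
  have hd1 : (1:ℝ) ≤ d := by exact_mod_cast hd
  have hb0 : 0 < hb := by rw [hhb]; unfold hPl; positivity
  have hbN : hb * (N + d / 2) = E := by
    rw [hhb]; unfold hPl; field_simp
  set T := 4 * Hfun x ξ / hb with hT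
  have hTge : 4 * ε / hb ≤ T := by rw [hT]; gcongr
  have hT0 : 0 < T := lt_of_lt_of_le (by positivity) hTge
  have hsum : ∑ j, 2 * (1 / hb * (x j ^ 2 + ξ j ^ 2)) = T := by
    rw [hT]; unfold Hfun
    rw [← Finset.mul_sum, ← Finset.mul_sum, Finset.sum_add_distrib]
    field_simp
    ring
  have key := lag_sum_bound d (fun j => 2 * (1 / hb * (x j ^ 2 + ξ j ^ 2))) T hT0 hsum N
  rw [wigner_eq d hb hb0, ← hT, Complex.norm_real, Real.norm_eq_abs, abs_mul, abs_mul, abs_mul,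
    abs_mul, abs_of_pos (Real.exp_pos _), abs_pow (-1 : ℝ), abs_neg, abs_one, one_pow, mul_one,
    abs_of_pos (by positivity : (0:ℝ) < 2 ^ d),
    abs_of_pos (by positivity : (0:ℝ) < ((2 * π * hb) ^ d)⁻¹)]
  have h1 : 2 * ((N:ℝ) + d) / T ≤ E / ε := by
    rw [div_le_div_iff₀ hT0 hε]
    have h2 : 4 * ε ≤ T * hb := (div_le_iff₀ hb0).1 hTge
    rw [← hbN]
    have h3 : 0 < (N:ℝ) + d / 2 := by positivity
    calc 2 * ((N:ℝ) + d) * ε ≤ (N + d / 2) * (4 * ε) := by nlinarith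
      _ ≤ (N + d / 2) * (T * hb) := by gcongr
      _ = _ := by ring
  have h4 : T ^ (-(1:ℝ) / 3) ≤ (4 * ε) ^ (-(1:ℝ) / 3) * hb ^ ((1:ℝ) / 3) := by
    have := Real.rpow_le_rpow_of_nonpos (z := -(1:ℝ) / 3) (by positivity : 0 < 4 * ε / hb) hTge
      (by norm_num)
    refine this.trans (le_of_eq ?_)
    rw [Real.div_rpow (by positivity) hb0.le, div_eq_mul_inv, ← Real.rpow_neg hb0.le]
    norm_num
  calc ((2 * π * hb) ^ d)⁻¹ * (2 ^ d * (Real.exp (-T / 2) * |_|))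
      ≤ ((2 * π * hb) ^ d)⁻¹ * (2 ^ d * (12 * (2 * (N + d) / T) ^ d * T ^ (-(1:ℝ) / 3))) := by
        gcongr
    _ ≤ ((2 * π * hb) ^ d)⁻¹ * (2 ^ d * (12 * (E / ε) ^ d *
          ((4 * ε) ^ (-(1:ℝ) / 3) * hb ^ ((1:ℝ) / 3)))) := by
        gcongr
    _ = (π ^ d)⁻¹ * (12 * (E / ε) ^ d * (4 * ε) ^ (-(1:ℝ) / 3)) * hb ^ (-(d : ℝ) + 1 / 3) := by
        rw [Real.rpow_add hb0, Real.rpow_neg hb0.le, Real.rpow_natCast, mul_pow, mul_pow]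
        field_simp
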